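/- Let X ⊆ FIN_{A⋆} be an infinite block sequence and let f : [X]_A → C be a coloring into a finite set C. Then there exist a finite set F ⊆ [X]_{A⋆} and an infinite block sequence Y ⊆ [X − F]_{A⋆} such that F half-matches Y, i.e., F half-matches Y for every color i ∈ C. -/

import Mathlib

namespace Carlson

/-- The domain of a partial function `ℕ →. B`, encoded as `ℕ → Option B`. -/
def dom {B : Type*} (p : ℕ → Option B) : Set ℕ := {n | p n ≠ none}

/-- `p` is a located word over `B`: a partial function with finite nonempty domain. -/
def IsLW {B : Type*} (p : ℕ → Option B) : Prop := (dom p).Finite ∧ (dom p).Nonempty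

/-- A located variable word over `A` is a located word over `Option A`
(where `none` encodes the variable `⋆`) taking the value `⋆` at least once. -/
def IsLVW {A : Type*} (p : ℕ → Option (Option A)) : Prop :=
  IsLW p ∧ ∃ n, p n = some none

/-- `p < q`: every element of the domain of `p` is below every element of the domain of `q`. -/
def blt {B : Type*} (p q : ℕ → Option B) : Prop :=
  ∀ m ∈ dom p, ∀ n ∈ dom q, m < n

/-- Union `p ∪ q` of two partial functions (`p` takes precedence; for `blt p q`
the domains are disjoint, so this is the genuine union). -/
def pun {B : Type*} (p q : ℕ → Option B) : ℕ → Option B :=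
  fun n => (p n).elim (q n) some

/-- The empty partial function. -/
def emptyW {B : Type*} : ℕ → Option B := fun _ => none

/-- `p[a]`: substitution of the letter `a ∈ A` for the variable `⋆` in a located
variable word. -/
def substA {A : Type*} (p : ℕ → Option (Option A)) (a : A) : ℕ → Option A :=
  fun n => (p n).map fun x => x.getD a

/-- `p[a]` for `a ∈ A ∪ {⋆}` (with `none` encoding `⋆`, so `p[⋆] = p`). -/
def substV {A : Type*} (p : ℕ → Option (Option A)) (a : Option A) : ℕ → Option (Option A) :=
  fun n => (p n).map fun x => x.elim a some

/-- Union of a finite family of partial functions with pairwise disjoint domains. -/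
def famUnion {B : Type*} {k : ℕ} (g : Fin k → ℕ → Option B) : ℕ → Option B :=
  fun n => ((List.ofFn fun i => g i n).filterMap id).head?

/-- A block sequence: a set of located variable words totally ordered by `<`. -/
def IsBlockSeq {A : Type*} (X : Set (ℕ → Option (Option A))) : Prop :=
  (∀ p ∈ X, IsLVW p) ∧ ∀ p ∈ X, ∀ q ∈ X, p = q ∨ blt p q ∨ blt q p

/-- `[X]_A`: located words of the form `p₀[a₀] ∪ ⋯ ∪ p_k[a_k]` with `p₀ < ⋯ < p_k`
all in `X` and `a₀, …, a_k ∈ A`. -/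
def combA {A : Type*} (X : Set (ℕ → Option (Option A))) : Set (ℕ → Option A) :=
  { q | ∃ (k : ℕ) (p : Fin (k + 1) → ℕ → Option (Option A)) (a : Fin (k + 1) → A),
      (∀ i, p i ∈ X) ∧ (∀ i j : Fin (k + 1), i < j → blt (p i) (p j)) ∧
      q = famUnion fun i => substA (p i) (a i) }

/-- `[X]_{A⋆}`: located variable words of the form `p₀[a₀] ∪ ⋯ ∪ p_k[a_k]` with
`p₀ < ⋯ < p_k` all in `X`, `a₀, …, a_k ∈ A ∪ {⋆}`, and `⋆` used at least once. -/
def combV {A : Type*} (X : Set (ℕ → Option (Option A))) : Set (ℕ → Option (Option A)) :=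
  { q | ∃ (k : ℕ) (p : Fin (k + 1) → ℕ → Option (Option A)) (a : Fin (k + 1) → Option A),
      (∀ i, p i ∈ X) ∧ (∀ i j : Fin (k + 1), i < j → blt (p i) (p j)) ∧
      (∃ i, a i = none) ∧ q = famUnion fun i => substV (p i) (a i) }

/-- `X − F`: the elements of `X` whose domain lies entirely above the domains of
all members of `F`. -/
def sminus {B : Type*} (X F : Set (ℕ → Option B)) : Set (ℕ → Option B) :=
  { q ∈ X | ∀ p ∈ F, blt p q }

/-- `dom q ⊆ [0, ℓ)`. -/
def domBelow {B : Type*} (q : ℕ → Option B) (ℓ : ℕ) : Prop := ∀ n ∈ dom q, n < ℓ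

/-- `dom q ⊆ [m, ∞)`. -/
def domAbove {B : Type*} (q : ℕ → Option B) (m : ℕ) : Prop := ∀ n ∈ dom q, m ≤ n

/-- `S^ℓ_p(f) = S^ℓ_{p'}(g)` for colorings of located words: agreement at `q ∪ p`
vs `q ∪ p'` for every located word `q` with domain contained in `[0, ℓ)`.
(Take `p' = emptyW` to express `S^ℓ_p(f) = S^ℓ(g)`.) -/
def SEq {A C : Type*} (f g : (ℕ → Option A) → C) (ℓ : ℕ) (p p' : ℕ → Option A) : Prop :=
  ∀ q : ℕ → Option A, IsLW q → domBelow q ℓ → f (pun q p) = g (pun q p')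

/-- Variant of `SEq` for colorings that are also defined at the empty located word,
i.e. `q` ranges over `FIN_A(0, ℓ) ∪ {∅}`. -/
def SEq0 {A C : Type*} (f g : (ℕ → Option A) → C) (ℓ : ℕ) (p p' : ℕ → Option A) : Prop :=
  ∀ q : ℕ → Option A, (dom q).Finite → domBelow q ℓ → f (pun q p) = g (pun q p')

/-- A coloring `f` is recurrent if for every `ℓ` there is a located variable word `p`
with domain in `[ℓ, ∞)` such that `S^ℓ_{p[a]}(f) = S^ℓ(f)` for every `a ∈ A`. -/
def Recurrent {A C : Type*} (f : (ℕ → Option A) → C) : Prop :=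
  ∀ ℓ : ℕ, ∃ p : ℕ → Option (Option A), IsLVW p ∧ domAbove p ℓ ∧
    ∀ a : A, SEq f f ℓ (substA p a) emptyW

/-- A coloring `f` is uniformly recurrent if for every `ℓ` there is `m > ℓ` such that
for every `p ∈ FIN_A(m, ∞)` there is `q ∈ FIN_A(ℓ, m)` with `S^ℓ_{q ∪ p}(f) = S^ℓ(f)`. -/
def UnifRecurrent {A C : Type*} (f : (ℕ → Option A) → C) : Prop :=
  ∀ ℓ : ℕ, ∃ m : ℕ, ℓ < m ∧ ∀ p : ℕ → Option A, IsLW p → domAbove p m →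
    ∃ q : ℕ → Option A, IsLW q ∧ domAbove q ℓ ∧ domBelow q m ∧
      SEq f f ℓ (pun q p) emptyW

/-- `f` and `g` are weakly proximal: for every `ℓ` there is `p ∈ FIN_A(ℓ, ∞)` with
`S^ℓ_p(f) = S^ℓ_p(g)`. -/
def WeakProx {A C : Type*} (f g : (ℕ → Option A) → C) : Prop :=
  ∀ ℓ : ℕ, ∃ p : ℕ → Option A, IsLW p ∧ domAbove p ℓ ∧ SEq f g ℓ p p

/-- `g` is strongly proximal to `f`: for every `ℓ` there is a located variable word `p`
with domain in `[ℓ, ∞)` such that `S^ℓ(g) = S^ℓ_{p[a]}(g) = S^ℓ_{p[a]}(f)` for all `a ∈ A`. -/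
def StrongProx {A C : Type*} (g f : (ℕ → Option A) → C) : Prop :=
  ∀ ℓ : ℕ, ∃ p : ℕ → Option (Option A), IsLVW p ∧ domAbove p ℓ ∧
    ∀ a : A, SEq g g ℓ emptyW (substA p a) ∧ SEq g f ℓ (substA p a) (substA p a)

/-- `Recurrent` for colorings also defined at the empty located word. -/
def Recurrent0 {A C : Type*} (f : (ℕ → Option A) → C) : Prop :=
  ∀ ℓ : ℕ, ∃ p : ℕ → Option (Option A), IsLVW p ∧ domAbove p ℓ ∧
    ∀ a : A, SEq0 f f ℓ (substA p a) emptyW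

/-- `StrongProx` for colorings also defined at the empty located word. -/
def StrongProx0 {A C : Type*} (g f : (ℕ → Option A) → C) : Prop :=
  ∀ ℓ : ℕ, ∃ p : ℕ → Option (Option A), IsLVW p ∧ domAbove p ℓ ∧
    ∀ a : A, SEq0 g g ℓ emptyW (substA p a) ∧ SEq0 g f ℓ (substA p a) (substA p a)

/-- Agreement of two colorings on all located words with domain in `[0, ℓ)`. -/
def AgreeBelow {A C : Type*} (f g : (ℕ → Option A) → C) (ℓ : ℕ) : Prop :=
  ∀ q : ℕ → Option A, IsLW q → domBelow q ℓ → f q = g q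

/-- Closedness of a class in `C^{FIN_A}` with the product topology (`C` discrete):
a class is closed iff it contains every coloring all of whose finite restrictions
(to located words with domain in `[0, ℓ)`, for each `ℓ`) are matched within the class. -/
def IsClosedColl {A C : Type*} (𝓒 : Set ((ℕ → Option A) → C)) : Prop :=
  ∀ f, (∀ ℓ : ℕ, ∃ g ∈ 𝓒, AgreeBelow f g ℓ) → f ∈ 𝓒

/-- A subshift: a nonempty closed class `𝓒 ⊆ C^{FIN_A}` such that for every `f ∈ 𝓒`,
`ℓ ∈ ℕ` and `p ∈ FIN_A(ℓ, ∞)` there is `g ∈ 𝓒` with `S^ℓ(g) = S^ℓ_p(f)`. -/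
def IsSubshift {A C : Type*} (𝓒 : Set ((ℕ → Option A) → C)) : Prop :=
  𝓒.Nonempty ∧ IsClosedColl 𝓒 ∧
    ∀ f ∈ 𝓒, ∀ ℓ : ℕ, ∀ p : ℕ → Option A, IsLW p → domAbove p ℓ →
      ∃ g ∈ 𝓒, SEq g f ℓ emptyW p

/-- A minimal subshift: no subshift is a proper subset of it. -/
def IsMinimalSubshift {A C : Type*} (𝓒 : Set ((ℕ → Option A) → C)) : Prop :=
  IsSubshift 𝓒 ∧ ∀ 𝓓 : Set ((ℕ → Option A) → C), IsSubshift 𝓓 → 𝓓 ⊆ 𝓒 → 𝓓 = 𝓒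

/-- The orbit closure of a coloring `f`: all `g` such that for every `ℓ` and every
`q ∈ FIN_A(ℓ, ∞)` there is `p ∈ FIN_A(ℓ, ∞)` with `S^ℓ_q(g) = S^ℓ_p(f)`. -/
def orbCl {A C : Type*} (f : (ℕ → Option A) → C) : Set ((ℕ → Option A) → C) :=
  { g | ∀ ℓ : ℕ, ∀ q : ℕ → Option A, IsLW q → domAbove q ℓ →
      ∃ p : ℕ → Option A, IsLW p ∧ domAbove p ℓ ∧ SEq g f ℓ q p }

/-- A variable word over `A`, encoded as a list over `Option A` with `none` = `⋆`:
the variable must occur at least once. -/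
def IsVarWord {A : Type*} (w : List (Option A)) : Prop := none ∈ w

/-- `w[a]`: replace every occurrence of the variable `⋆` by the letter `a`. -/
def substW {A : Type*} (w : List (Option A)) (a : A) : List A :=
  w.map fun x => x.getD a

/-- `⟨(w_n)_{n∈ℕ}⟩_A`: the words `w_{j₀}[a₀] ⋯ w_{j_{k-1}}[a_{k-1}]` extracted from
the sequence `(w_n)`, for `j₀ < ⋯ < j_{k-1}` and letters `a₀, …, a_{k-1} ∈ A`. -/
def extracted {A : Type*} (w : ℕ → List (Option A)) : Set (List A) :=
  { u | ∃ (k : ℕ) (j : Fin (k + 1) → ℕ) (a : Fin (k + 1) → A),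
      StrictMono j ∧ u = (List.ofFn fun i => substW (w (j i)) (a i)).flatten }

section Ultrafilters

open Filter

attribute [local instance] Ultrafilter.mul Ultrafilter.semigroup

variable {S T : Type*} [Semigroup S] [Semigroup T]

/-- The ultrafilters containing every term of a sequence of sets. -/
def ultraIn {M : Type*} (P : ℕ → Set M) : Set (Ultrafilter M) := {u | ∀ n, P n ∈ u}

theorem isClosed_ultraIn {M : Type*} (P : ℕ → Set M) : IsClosed (ultraIn P) := by
  have h : ultraIn P = ⋂ n, {u : Ultrafilter M | P n ∈ u} := by
    ext u
    simp [ultraIn]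
  rw [h]
  exact isClosed_iInter fun n => ultrafilter_isClosed_basic _

theorem ultraIn_nonempty {M : Type*} {P : ℕ → Set M} (hP : Antitone P)
    (hne : ∀ n, (P n).Nonempty) : (ultraIn P).Nonempty := by
  choose s hs using hne
  refine ⟨Ultrafilter.of (atTop.map s), fun n => ?_⟩
  refine (Ultrafilter.of_le (atTop.map s) : _ ≤ _) ?_
  exact mem_map.2 (mem_atTop_sets.2 ⟨n, fun k hk => hP hk (hs k)⟩)

theorem mul_mem_ultraIn {P Q R : ℕ → Set S}
    (h : ∀ n, ∀ p ∈ P n, ∃ m, ∀ q ∈ Q m, p * q ∈ R n) {u v : Ultrafilter S}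
    (hu : u ∈ ultraIn P) (hv : v ∈ ultraIn Q) : u * v ∈ ultraIn R := by
  intro n
  refine (Ultrafilter.eventually_mul u v (· ∈ R n)).2 ?_
  filter_upwards [hu n] with p hp
  obtain ⟨m, hm⟩ := h n p hp
  filter_upwards [hv m] with q hq using hm q hq

theorem map_mem_ultraIn {M N : Type*} {P : ℕ → Set M} {Q : ℕ → Set N} {φ : M → N}
    (h : ∀ n, ∀ p ∈ P n, φ p ∈ Q n) {u : Ultrafilter M} (hu : u ∈ ultraIn P) :
    u.map φ ∈ ultraIn Q := fun n =>
  Ultrafilter.mem_map.2 (mem_of_superset (hu n) (h n))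

theorem ultrafilter_map_mul (φ : S →ₙ* T) (u v : Ultrafilter S) :
    (u * v).map φ = u.map φ * v.map φ := by
  refine Ultrafilter.ext fun s => ?_
  change (∀ᶠ x in u, ∀ᶠ y in v, φ (x * y) ∈ s) ↔ ∀ᶠ x in u, ∀ᶠ y in v, φ x * φ y ∈ s
  simp only [map_mul]

/-- A closed subsemigroup of a compact right topological semigroup contains an idempotent which
is minimal for the order `e ≤ u ↔ e * u = e ∧ u * e = e` on the idempotents of the subsemigroup. -/
theorem exists_minimal_idempotent {M : Type*} [Semigroup M] [TopologicalSpace M] [CompactSpace M]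
    [T2Space M] (hc : ∀ r : M, Continuous (· * r)) {K : Set M} (hK : IsClosed K)
    (hne : K.Nonempty) (hmul : ∀ x ∈ K, ∀ y ∈ K, x * y ∈ K) :
    ∃ u ∈ K, u * u = u ∧ ∀ e ∈ K, e * e = e → e * u = e → u * e = e → e = u := by
  let I : Set (Set M) :=
    {L | IsClosed L ∧ L.Nonempty ∧ L ⊆ K ∧ ∀ x ∈ K, ∀ y ∈ L, x * y ∈ L}
  obtain ⟨L, -, hL⟩ : ∃ L ⊆ K, Minimal (· ∈ I) L := by
    refine zorn_superset_nonempty I (fun c hcI hchain hcne => ?_) K ⟨hK, hne, le_rfl, hmul⟩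
    refine ⟨⋂₀ c, ⟨isClosed_sInter fun s hs => (hcI hs).1, ?_, ?_, ?_⟩,
      fun s hs => Set.sInter_subset_of_mem hs⟩
    · have : Nonempty c := hcne.to_subtype
      exact IsCompact.nonempty_sInter_of_directed_nonempty_isCompact_isClosed
        (IsChain.directedOn hchain.symm) (fun s hs => (hcI hs).2.1)
        (fun s hs => (hcI hs).1.isCompact) (fun s hs => (hcI hs).1)
    · obtain ⟨s, hs⟩ := hcne
      exact (Set.sInter_subset_of_mem hs).trans (hcI hs).2.2.1
    · exact fun x hx y hy s hs => (hcI hs).2.2.2 x hx y (hy s hs)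
  obtain ⟨hLcl, hLne, hLK, hLmul⟩ := hL.prop
  obtain ⟨u, huL, huu⟩ := exists_idempotent_in_compact_subsemigroup hc L hLne hLcl.isCompact
    fun x hx y hy => hLmul x (hLK hx) y hy
  refine ⟨u, hLK huL, huu, fun e he hee heu hue => ?_⟩
  have heL : e ∈ L := heu ▸ hLmul e he u huL
  have hsub : (· * e) '' K ⊆ L := by
    rintro _ ⟨x, hx, rfl⟩
    exact hLmul x hx e heL
  have hI : (· * e) '' K ∈ I := by
    refine ⟨(hK.isCompact.image (hc e)).isClosed, hne.image _, hsub.trans hLK, ?_⟩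
    rintro x hx _ ⟨y, hy, rfl⟩
    exact ⟨x * y, hmul x hx y hy, mul_assoc x y e⟩
  obtain ⟨x, -, hx⟩ := hL.le_of_le hI hsub huL
  calc e = u * e := hue.symm
    _ = x * e * e := by rw [← hx]
    _ = u := by rw [mul_assoc, hee]; exact hx

/-- Given semigroups `S` and `T` with an embedding `ι : S → T` and retractions `σ a : T → S`, and
closed semigroups `K`, `L` of ultrafilters such that `L` absorbs `K` and retracts to it, there are
idempotents `u ∈ K` and `v ∈ L` such that each `σ a` sends `v` to `u`. -/
theorem exists_idempotent_retracting {A : Type*} (ι : S →ₙ* T) (σ : A → T →ₙ* S)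
    (hσι : ∀ a s, σ a (ι s) = s) {K : Set (Ultrafilter S)} {L : Set (Ultrafilter T)}
    (hK : IsClosed K) (hKne : K.Nonempty) (hKmul : ∀ x ∈ K, ∀ y ∈ K, x * y ∈ K)
    (hL : IsClosed L) (hLne : L.Nonempty) (hLmul : ∀ x ∈ L, ∀ y ∈ L, x * y ∈ L)
    (hLK : ∀ x ∈ L, ∀ u ∈ K, x * u.map ι ∈ L) (hKL : ∀ u ∈ K, ∀ x ∈ L, u.map ι * x ∈ L)
    (hσ : ∀ a, ∀ x ∈ L, x.map (σ a) ∈ K) :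
    ∃ u ∈ K, ∃ v ∈ L, u * u = u ∧ ∀ a, v.map (σ a) = u := by
  obtain ⟨u, huK, huu, hmin⟩ :=
    exists_minimal_idempotent Ultrafilter.continuous_mul_left hK hKne hKmul
  set u' : Ultrafilter T := u.map ι with hu'
  have huu' : u' * u' = u' := by rw [hu', ← ultrafilter_map_mul, huu]
  obtain ⟨_, ⟨x, hx, rfl⟩, hw⟩ :=
    exists_idempotent_in_compact_subsemigroup Ultrafilter.continuous_mul_left ((· * u') '' L)
      (hLne.image _) (hL.isCompact.image (Ultrafilter.continuous_mul_left u')) (by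
        rintro _ ⟨x, hx, rfl⟩ _ ⟨y, hy, rfl⟩
        exact ⟨x * u' * y, hLmul _ (hLK x hx u huK) y hy, mul_assoc _ _ _⟩)
  simp only at hw
  set w := x * u' with hwdef
  have hwu : w * u' = w := by rw [hwdef, mul_assoc, huu']
  have hvv : u' * w * (u' * w) = u' * w := by
    rw [mul_assoc, ← mul_assoc w, hwu, hw]
  have hσu : ∀ a, u'.map (σ a) = u := fun a => by
    rw [hu', Ultrafilter.map_map]
    have : σ a ∘ ι = id := funext (hσι a)
    rw [this, Ultrafilter.map_id]
  have hvL : u' * w ∈ L := hKL u huK w (hLK x hx u huK)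
  refine ⟨u, huK, u' * w, hvL, huu, fun a => hmin _ (hσ a _ hvL) ?_ ?_ ?_⟩
  · rw [← ultrafilter_map_mul, hvv]
  · rw [← hσu a, ← ultrafilter_map_mul, mul_assoc, hwu]
  · rw [← hσu a, ← ultrafilter_map_mul, ← mul_assoc, huu']

/-- The recursive selection behind Galvin's argument: an ultrafilter `v` all of whose images under
the maps `σ a` are the idempotent `u` yields a sequence `y` and decreasing sets `D n`, starting
inside a given member of `u`, with `σ a (y n)` in `D n` and `σ a (y n) * D (n + 1) ⊆ D n`. -/
theorem exists_seq_of_idempotent {A T : Type*} [Finite A] {u : Ultrafilter S} (huu : u * u = u)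
    {v : Ultrafilter T} {σ : A → T → S} (hv : ∀ a, v.map (σ a) = u) {P : Set S} (hP : P ∈ u)
    {V : ℕ → Set T} (hV : ∀ n, V n ∈ v) {R : T → ℕ → Prop}
    (hR : ∀ n, ∀ y ∈ V n, ∃ m, n ≤ m ∧ R y m) :
    ∃ (y : ℕ → T) (m : ℕ → ℕ) (D : ℕ → Set S), D 0 ⊆ P ∧ Monotone m ∧ Antitone D ∧
      (∀ n, y n ∈ V (m n)) ∧ (∀ n, R (y n) (m (n + 1))) ∧
      (∀ n a, σ a (y n) ∈ D n) ∧ ∀ n a, ∀ s ∈ D (n + 1), σ a (y n) * s ∈ D n := by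
  let Good : Set S × ℕ → Prop := fun E => E.1 ∈ u ∧ ∀ s ∈ E.1, ∀ᶠ t in u, s * t ∈ E.1
  have step : ∀ E : {E // Good E}, ∃ (y : T) (E' : {E // Good E}),
      y ∈ V E.1.2 ∧ E.1.2 ≤ E'.1.2 ∧ R y E'.1.2 ∧ E'.1.1 ⊆ E.1.1 ∧
      (∀ a, σ a y ∈ E.1.1) ∧ ∀ a, ∀ s ∈ E'.1.1, σ a y * s ∈ E.1.1 := by
    rintro ⟨⟨D, n⟩, hD, hstar⟩
    have hy : ∀ᶠ y in v, y ∈ V n ∧ ∀ a, σ a y ∈ D :=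
      (show ∀ᶠ y in v, y ∈ V n from hV n).and (eventually_all.2 fun a => by
        have : D ∈ v.map (σ a) := (hv a).symm ▸ hD
        exact this)
    obtain ⟨y, hyV, hyD⟩ := hy.exists
    obtain ⟨m, hnm, hRm⟩ := hR n y hyV
    refine ⟨y, ⟨⟨{s | s ∈ D ∧ ∀ a, σ a y * s ∈ D}, m⟩, ?_, ?_⟩, hyV, hnm, hRm,
      fun s hs => hs.1, hyD, fun a s hs => hs.2 a⟩
    · exact (show ∀ᶠ s in u, s ∈ D from hD).and (eventually_all.2 fun a => hstar _ (hyD a))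
    · rintro s ⟨hs, hsy⟩
      refine (hstar s hs).and (eventually_all.2 fun a => ?_)
      filter_upwards [hstar _ (hsy a)] with t ht
      rwa [← mul_assoc]
  choose y next h1 h2 h3 h4 h5 h6 using step
  have hP' : ∀ᶠ s in u, ∀ᶠ t in u, s * t ∈ P := by
    rw [← Ultrafilter.eventually_mul, huu]
    exact hP
  have h0 : Good ({s | s ∈ P ∧ ∀ᶠ t in u, s * t ∈ P}, 0) := by
    refine ⟨(show ∀ᶠ s in u, s ∈ P from hP).and hP', ?_⟩
    rintro s ⟨-, hs⟩
    refine hs.and ?_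
    rw [← huu, Ultrafilter.eventually_mul] at hs
    simpa only [mul_assoc] using hs
  let E : ℕ → {E // Good E} := fun n => n.rec ⟨_, h0⟩ fun _ => next
  exact ⟨fun n => y (E n), fun n => (E n).1.2, fun n => (E n).1.1, fun s hs => hs.1,
    monotone_nat_of_le_succ fun n => h2 (E n), antitone_nat_of_succ_le fun n => h4 (E n),
    fun n => h1 (E n), fun n => h3 (E n), fun n => h5 (E n), fun n => h6 (E n)⟩

theorem prod_mem_of_seq {A S T : Type*} [Monoid S] {σ : A → T → S} {y : ℕ → T} {D : ℕ → Set S}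
    (hD : Antitone D) (hy : ∀ n a, σ a (y n) ∈ D n)
    (hmul : ∀ n a, ∀ s ∈ D (n + 1), σ a (y n) * s ∈ D n) (n : ℕ) {l : List (ℕ × A)} (hne : l ≠ [])
    (hl : l.Pairwise fun x z => x.1 < z.1) (hn : ∀ x ∈ l, n ≤ x.1) :
    (l.map fun x => σ x.2 (y x.1)).prod ∈ D n := by
  induction l generalizing n with
  | nil => exact absurd rfl hne
  | cons x l ih =>
    refine hD (hn x List.mem_cons_self) ?_
    rcases eq_or_ne l [] with rfl | hl'
    · simpa using hy x.1 x.2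
    · rw [List.pairwise_cons] at hl
      simpa using hmul x.1 x.2 _ (ih (x.1 + 1) hl' hl.2 hl.1)

end Ultrafilters

section Words

attribute [local instance] Ultrafilter.mul Ultrafilter.semigroup

variable {A B : Type*}

/-- Partial functions form a monoid under left-biased union. -/
instance : Monoid (ℕ → Option B) where
  mul := pun
  one := emptyW
  mul_assoc p q r := by
    funext n
    change pun (pun p q) r n = pun p (pun q r) n
    unfold pun
    cases p n <;> rfl
  one_mul p := rfl
  mul_one p := by
    funext n
    change pun p emptyW n = p n
    unfold pun emptyW
    cases p n <;> rfl

theorem word_mul_apply (p q : ℕ → Option B) (n : ℕ) : (p * q) n = (p n).elim (q n) some := rfl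

/-- Substitution of a letter, as a monoid homomorphism. -/
def substHom (a : A) : (ℕ → Option (Option A)) →* (ℕ → Option A) where
  toFun p := substA p a
  map_one' := rfl
  map_mul' p q := by
    funext n
    change ((p * q) n).map _ = ((p n).map _).elim ((q n).map _) some
    rw [word_mul_apply]
    cases p n <;> rfl

/-- Located words regarded as words over `A ∪ {⋆}` without variable. -/
def constHom (A : Type*) : (ℕ → Option A) →* (ℕ → Option (Option A)) where
  toFun p n := (p n).map some
  map_one' := rfl
  map_mul' p q := by
    funext n
    change ((p * q) n).map _ = ((p n).map _).elim ((q n).map _) some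
    rw [word_mul_apply]
    cases p n <;> rfl

theorem substHom_constHom (a : A) (p : ℕ → Option A) : substHom a (constHom A p) = p := by
  funext n
  change ((p n).map some).map _ = p n
  cases p n <;> rfl

theorem constHom_substA (p : ℕ → Option (Option A)) (a : A) :
    constHom A (substA p a) = substV p (some a) := by
  funext n
  change ((p n).map _).map some = (p n).map _
  rcases p n with _ | _ | _ <;> rfl

theorem substHom_substV (p : ℕ → Option (Option A)) (x : Option A) (a : A) :
    substHom a (substV p x) = substA p (x.getD a) := by
  funext n
  change ((p n).map _).map _ = (p n).map _
  rcases p n with _ | _ | _ <;> cases x <;> rfl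

theorem substV_none (p : ℕ → Option (Option A)) : substV p none = p := by
  funext n
  change (p n).map _ = p n
  rcases p n with _ | _ | _ <;> rfl

theorem dom_mul (p q : ℕ → Option B) : dom (p * q) = dom p ∪ dom q := by
  ext n
  simp only [dom, Set.mem_ofPred_eq, Set.mem_union, word_mul_apply]
  cases p n <;> simp

theorem dom_substV (p : ℕ → Option (Option A)) (x : Option A) : dom (substV p x) = dom p := by
  ext n
  simp [dom, substV]

theorem mem_dom_prod (l : List ((ℕ → Option (Option A)) × Option A)) (n : ℕ) :
    n ∈ dom (l.map fun x => substV x.1 x.2).prod ↔ ∃ x ∈ l, n ∈ dom x.1 := by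
  induction l with
  | nil => simp [dom, show (1 : ℕ → Option (Option A)) = emptyW from rfl, emptyW]
  | cons x l ih => simp [dom_mul, dom_substV, ih]

theorem famUnion_eq_prod {k : ℕ} (g : Fin k → ℕ → Option B) :
    famUnion g = (List.ofFn g).prod := by
  induction k with
  | zero => rfl
  | succ k ih =>
    rw [List.ofFn_succ, List.prod_cons, ← ih]
    funext n
    rw [word_mul_apply]
    simp only [famUnion, List.ofFn_succ]
    cases g 0 n <;> rfl

/-- A list of members of `X` labelled by `L`, increasing in the block order. -/
def IsBlockList {L : Type*} (X : Set (ℕ → Option (Option A)))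
    (l : List ((ℕ → Option (Option A)) × L)) : Prop :=
  (∀ x ∈ l, x.1 ∈ X) ∧ l.Pairwise fun x y => blt x.1 y.1

theorem isBlockList_ofFn {L : Type*} {X : Set (ℕ → Option (Option A))} {k : ℕ}
    {p : Fin k → ℕ → Option (Option A)} {a : Fin k → L} :
    IsBlockList X (List.ofFn fun i => (p i, a i)) ↔
      (∀ i, p i ∈ X) ∧ ∀ i j : Fin k, i < j → blt (p i) (p j) := by
  rw [IsBlockList, List.pairwise_ofFn, List.forall_mem_ofFn_iff]

theorem exists_eq_ofFn {L M : Type*} {l : List (M × L)} (hl : l ≠ []) :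
    ∃ (k : ℕ) (p : Fin (k + 1) → M) (a : Fin (k + 1) → L), l = List.ofFn fun i => (p i, a i) := by
  cases l with
  | nil => exact absurd rfl hl
  | cons x l =>
    exact ⟨l.length, fun i => ((x :: l).get i).1, fun i => ((x :: l).get i).2,
      (List.ofFn_get (x :: l)).symm⟩

theorem mem_combA_iff {X : Set (ℕ → Option (Option A))} {q : ℕ → Option A} :
    q ∈ combA X ↔ ∃ l : List ((ℕ → Option (Option A)) × A), l ≠ [] ∧ IsBlockList X l ∧
      q = (l.map fun x => substA x.1 x.2).prod := by
  constructor
  · rintro ⟨k, p, a, hX, hlt, rfl⟩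
    refine ⟨List.ofFn fun i => (p i, a i), by simp, isBlockList_ofFn.2 ⟨hX, hlt⟩, ?_⟩
    rw [famUnion_eq_prod, List.map_ofFn]
    rfl
  · rintro ⟨l, hne, hl, rfl⟩
    obtain ⟨k, p, a, rfl⟩ := exists_eq_ofFn hne
    obtain ⟨hX, hlt⟩ := isBlockList_ofFn.1 hl
    refine ⟨k, p, a, hX, hlt, ?_⟩
    rw [famUnion_eq_prod, List.map_ofFn]
    rfl

theorem mem_combV_iff {X : Set (ℕ → Option (Option A))} {q : ℕ → Option (Option A)} :
    q ∈ combV X ↔ ∃ l : List ((ℕ → Option (Option A)) × Option A), (∃ x ∈ l, x.2 = none) ∧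
      IsBlockList X l ∧ q = (l.map fun x => substV x.1 x.2).prod := by
  constructor
  · rintro ⟨k, p, a, hX, hlt, ⟨i, hi⟩, rfl⟩
    refine ⟨List.ofFn fun i => (p i, a i), ⟨(p i, a i), List.mem_ofFn.2 ⟨i, rfl⟩, hi⟩,
      isBlockList_ofFn.2 ⟨hX, hlt⟩, ?_⟩
    rw [famUnion_eq_prod, List.map_ofFn]
    rfl
  · rintro ⟨l, ⟨x, hxl, hx⟩, hl, rfl⟩
    obtain ⟨k, p, a, rfl⟩ := exists_eq_ofFn (List.ne_nil_of_mem hxl)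
    obtain ⟨i, rfl⟩ := List.mem_ofFn.1 hxl
    obtain ⟨hX, hlt⟩ := isBlockList_ofFn.1 hl
    refine ⟨k, p, a, hX, hlt, ⟨i, hx⟩, ?_⟩
    rw [famUnion_eq_prod, List.map_ofFn]
    rfl

theorem IsBlockList.mono {L : Type*} {X Y : Set (ℕ → Option (Option A))} (h : X ⊆ Y)
    {l : List ((ℕ → Option (Option A)) × L)} (hl : IsBlockList X l) : IsBlockList Y l :=
  ⟨fun x hx => h (hl.1 x hx), hl.2⟩

theorem IsBlockList.map_snd {L M : Type*} {X : Set (ℕ → Option (Option A))} (φ : L → M)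
    {l : List ((ℕ → Option (Option A)) × L)} (hl : IsBlockList X l) :
    IsBlockList X (l.map fun x => (x.1, φ x.2)) := by
  refine ⟨?_, List.pairwise_map.2 hl.2⟩
  simp only [List.mem_map]
  rintro _ ⟨x, hx, rfl⟩
  exact hl.1 x hx

theorem IsBlockList.finite_dom {L : Type*} {X : Set (ℕ → Option (Option A))} (hX : IsBlockSeq X)
    {l : List ((ℕ → Option (Option A)) × L)} (hl : IsBlockList X l) :
    {k | ∃ x ∈ l, k ∈ dom x.1}.Finite := by
  have : {k | ∃ x ∈ l, k ∈ dom x.1} = ⋃ x ∈ {x | x ∈ l}, dom x.1 := by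
    ext
    simp
  rw [this]
  exact (List.finite_toSet l).biUnion fun x hx => (hX.1 x.1 (hl.1 x hx)).1.1

theorem combA_mono {X Y : Set (ℕ → Option (Option A))} (h : X ⊆ Y) : combA X ⊆ combA Y := by
  rintro _ ⟨k, p, a, hX, hp⟩
  exact ⟨k, p, a, fun i => h (hX i), hp⟩

theorem combV_mono {X Y : Set (ℕ → Option (Option A))} (h : X ⊆ Y) : combV X ⊆ combV Y := by
  rintro _ ⟨k, p, a, hX, hp⟩
  exact ⟨k, p, a, fun i => h (hX i), hp⟩

theorem subset_combV {X : Set (ℕ → Option (Option A))} : X ⊆ combV X := fun p hp =>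
  mem_combV_iff.2 ⟨[(p, none)], by simp, ⟨by simpa using hp, by simp⟩, by simp [substV_none]⟩

theorem substA_mem_combA {X : Set (ℕ → Option (Option A))} {p : ℕ → Option (Option A)}
    (hp : p ∈ combV X) (a : A) : substA p a ∈ combA X := by
  obtain ⟨l, ⟨x, hx, -⟩, hl, rfl⟩ := mem_combV_iff.1 hp
  refine mem_combA_iff.2 ⟨l.map fun x => (x.1, x.2.getD a), ?_, hl.map_snd (·.getD a), ?_⟩
  · simpa using List.ne_nil_of_mem hx
  · change substHom a _ = _
    rw [map_list_prod, List.map_map, List.map_map]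
    congr 1
    exact List.map_congr_left fun x _ => substHom_substV x.1 x.2 a

theorem exists_list_of_constHom {X : Set (ℕ → Option (Option A))} {q : ℕ → Option A}
    (hq : q ∈ combA X) :
    ∃ l : List ((ℕ → Option (Option A)) × Option A), IsBlockList X l ∧
      constHom A q = (l.map fun x => substV x.1 x.2).prod := by
  obtain ⟨l, -, hl, rfl⟩ := mem_combA_iff.1 hq
  refine ⟨l.map fun x => (x.1, some x.2), hl.map_snd _, ?_⟩
  rw [map_list_prod, List.map_map, List.map_map]
  congr 1
  exact List.map_congr_left fun x _ => constHom_substA x.1 x.2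

/-- The members of `X` with domain in `[n, ∞)`. -/
def above (X : Set (ℕ → Option (Option A))) (n : ℕ) : Set (ℕ → Option (Option A)) :=
  {p ∈ X | domAbove p n}

theorem above_antitone (X : Set (ℕ → Option (Option A))) : Antitone (above X) :=
  fun _ _ h _ hp => ⟨hp.1, fun k hk => h.trans (hp.2 k hk)⟩

theorem exists_domBelow {p : ℕ → Option B} (hp : (dom p).Finite) (n : ℕ) :
    ∃ m, n ≤ m ∧ domBelow p m := by
  obtain ⟨b, hb⟩ := hp.bddAbove
  exact ⟨max n (b + 1), le_max_left _ _, fun k hk =>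
    (Nat.lt_succ_of_le (hb hk)).trans_le (le_max_right _ _)⟩

theorem above_nonempty {X : Set (ℕ → Option (Option A))} (hX : IsBlockSeq X) (hXinf : X.Infinite)
    (n : ℕ) : (above X n).Nonempty := by
  by_contra hne
  have h : ∀ p ∈ X, ∃ k ∈ dom p, k < n := fun p hp => by
    by_contra! hk
    exact hne ⟨p, hp, hk⟩
  choose! g hg hgn using h
  refine hXinf (Set.Finite.of_finite_image ((Set.finite_Iio n).subset ?_) (f := g) ?_)
  · rintro _ ⟨p, hp, rfl⟩
    exact hgn p hp
  · intro p hp q hq hpq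
    have hgq := hpq ▸ hg q hq
    rcases hX.2 p hp q hq with h | h | h
    · exact h
    · exact absurd (h _ (hg p hp) _ hgq) (lt_irrefl _)
    · exact absurd (h _ hgq _ (hg p hp)) (lt_irrefl _)

/-- A block list can be followed by any block list that lies far enough to the right. -/
theorem IsBlockList.exists_append {L : Type*} {X : Set (ℕ → Option (Option A))}
    (hX : IsBlockSeq X) {n : ℕ} {l : List ((ℕ → Option (Option A)) × L)}
    (hl : IsBlockList (above X n) l) :
    ∃ m, ∀ l', IsBlockList (above X m) l' → IsBlockList (above X n) (l ++ l') := by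
  have hbound : ∃ m, n ≤ m ∧ ∀ x ∈ l, domBelow x.1 m := by
    obtain ⟨b, hb⟩ := ((hl.mono fun _ h => h.1).finite_dom hX).bddAbove
    exact ⟨max n (b + 1), le_max_left _ _, fun x hx k hk =>
      (Nat.lt_succ_of_le (hb ⟨x, hx, hk⟩)).trans_le (le_max_right _ _)⟩
  obtain ⟨m, hnm, hm⟩ := hbound
  refine ⟨m, fun l' hl' => ⟨fun x hx => ?_, List.pairwise_append.2 ⟨hl.2, hl'.2, ?_⟩⟩⟩
  · rcases List.mem_append.1 hx with hx | hx
    · exact hl.1 x hx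
    · exact above_antitone X hnm (hl'.1 x hx)
  · exact fun x hx y hy i hi j hj => (hm x hx i hi).trans_le ((hl'.1 y hy).2 j hj)

theorem exists_mul_mem_combA_above {X : Set (ℕ → Option (Option A))} (hX : IsBlockSeq X)
    (n : ℕ) (p : ℕ → Option A) (hp : p ∈ combA (above X n)) :
    ∃ m, ∀ q ∈ combA (above X m), p * q ∈ combA (above X n) := by
  obtain ⟨l, hne, hl, rfl⟩ := mem_combA_iff.1 hp
  obtain ⟨m, hm⟩ := hl.exists_append hX
  refine ⟨m, fun q hq => ?_⟩
  obtain ⟨l', -, hl', rfl⟩ := mem_combA_iff.1 hq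
  exact mem_combA_iff.2 ⟨l ++ l', by simp [hne], hm l' hl', by simp⟩

theorem exists_mul_mem_combV_above {X : Set (ℕ → Option (Option A))} (hX : IsBlockSeq X)
    (n : ℕ) (p : ℕ → Option (Option A)) (hp : p ∈ combV (above X n)) :
    ∃ m, ∀ q ∈ combV (above X m), p * q ∈ combV (above X n) := by
  obtain ⟨l, ⟨x, hx, hx'⟩, hl, rfl⟩ := mem_combV_iff.1 hp
  obtain ⟨m, hm⟩ := hl.exists_append hX
  refine ⟨m, fun q hq => ?_⟩
  obtain ⟨l', -, hl', rfl⟩ := mem_combV_iff.1 hq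
  exact mem_combV_iff.2 ⟨l ++ l', ⟨x, by simp [hx], hx'⟩, hm l' hl', by simp⟩

theorem exists_mul_constHom_mem_combV_above {X : Set (ℕ → Option (Option A))} (hX : IsBlockSeq X)
    (n : ℕ) (p : ℕ → Option (Option A)) (hp : p ∈ combV (above X n)) :
    ∃ m, ∀ q ∈ constHom A '' combA (above X m), p * q ∈ combV (above X n) := by
  obtain ⟨l, ⟨x, hx, hx'⟩, hl, rfl⟩ := mem_combV_iff.1 hp
  obtain ⟨m, hm⟩ := hl.exists_append hX
  refine ⟨m, ?_⟩
  rintro _ ⟨q, hq, rfl⟩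
  obtain ⟨l', hl', heq⟩ := exists_list_of_constHom hq
  exact mem_combV_iff.2 ⟨l ++ l', ⟨x, by simp [hx], hx'⟩, hm l' hl', by simp [heq]⟩

theorem exists_constHom_mul_mem_combV_above {X : Set (ℕ → Option (Option A))} (hX : IsBlockSeq X)
    (n : ℕ) (p : ℕ → Option (Option A)) (hp : p ∈ constHom A '' combA (above X n)) :
    ∃ m, ∀ q ∈ combV (above X m), p * q ∈ combV (above X n) := by
  obtain ⟨p, hp, rfl⟩ := hp
  obtain ⟨l, hl, heq⟩ := exists_list_of_constHom hp
  obtain ⟨m, hm⟩ := hl.exists_append hX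
  refine ⟨m, fun q hq => ?_⟩
  obtain ⟨l', ⟨x, hx, hx'⟩, hl', rfl⟩ := mem_combV_iff.1 hq
  exact mem_combV_iff.2 ⟨l ++ l', ⟨x, by simp [hx], hx'⟩, hm l' hl', by simp [heq]⟩

theorem domAbove_of_mem_combV {X : Set (ℕ → Option (Option A))} {n : ℕ}
    {q : ℕ → Option (Option A)} (hq : q ∈ combV (above X n)) :
    domAbove q n := by
  obtain ⟨l, -, hl, rfl⟩ := mem_combV_iff.1 hq
  intro k hk
  obtain ⟨x, hx, hkx⟩ := (mem_dom_prod l k).1 hk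
  exact (hl.1 x hx).2 k hkx

theorem isLVW_of_mem_combV {X : Set (ℕ → Option (Option A))} (hX : IsBlockSeq X)
    {q : ℕ → Option (Option A)} (hq : q ∈ combV X) : IsLVW q := by
  obtain ⟨l, hstar, hl, rfl⟩ := mem_combV_iff.1 hq
  have hfin : (dom (l.map fun x => substV x.1 x.2).prod).Finite :=
    (hl.finite_dom hX).subset fun k => (mem_dom_prod l k).1
  have hval : ∃ n, (l.map fun x => substV x.1 x.2).prod n = some none := by
    clear hq hfin
    induction l with
    | nil => simp at hstar
    | cons x l ih =>
      simp only [List.map_cons, List.prod_cons, word_mul_apply]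
      by_cases hx : x.2 = none
      · obtain ⟨k, hk⟩ := (hX.1 x.1 (hl.1 x (by simp))).2
        exact ⟨k, by simp [hx, substV_none, hk]⟩
      · have hl' := List.pairwise_cons.1 hl.2
        obtain ⟨k, hk⟩ := ih (by simpa [hx] using hstar)
          ⟨fun y hy => hl.1 y (List.mem_cons_of_mem _ hy), hl'.2⟩
        refine ⟨k, ?_⟩
        obtain ⟨y, hy, hky⟩ := (mem_dom_prod l k).1 (by simp [dom, hk])
        have hkx : k ∉ dom (substV x.1 x.2) := by
          rw [dom_substV]
          exact fun h => lt_irrefl k (hl'.1 y hy k h k hky)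
        rw [show substV x.1 x.2 k = none by simpa [dom] using hkx]
        exact hk
  obtain ⟨k, hk⟩ := hval
  exact ⟨⟨hfin, k, by simp [dom, hk]⟩, k, hk⟩

theorem exists_idempotent_combA_combV [Nonempty A] {X : Set (ℕ → Option (Option A))}
    (hX : IsBlockSeq X) (hXinf : X.Infinite) :
    ∃ (u : Ultrafilter (ℕ → Option A)) (v : Ultrafilter (ℕ → Option (Option A))), u * u = u ∧
      (∀ n, combV (above X n) ∈ v) ∧ ∀ a : A, v.map (substA · a) = u := by
  obtain ⟨a₀⟩ := ‹Nonempty A›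
  have hV : ∀ n, (combV (above X n)).Nonempty := fun n =>
    (above_nonempty hX hXinf n).mono subset_combV
  have hconst {u} (hu : u ∈ ultraIn fun n => combA (above X n)) :
      u.map (constHom A) ∈ ultraIn fun n => constHom A '' combA (above X n) :=
    map_mem_ultraIn (fun _ _ => Set.mem_image_of_mem (constHom A)) hu
  obtain ⟨u, -, v, hv, huu, hvu⟩ := exists_idempotent_retracting
    (constHom A).toMulHom (fun a : A => (substHom a).toMulHom) substHom_constHom
    (isClosed_ultraIn fun n => combA (above X n))
    (ultraIn_nonempty (fun _ _ h => combA_mono (above_antitone X h)) fun n =>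
      (hV n).elim fun p hp => ⟨_, substA_mem_combA hp a₀⟩)
    (fun _ hx _ hy => mul_mem_ultraIn (exists_mul_mem_combA_above hX) hx hy)
    (isClosed_ultraIn fun n => combV (above X n))
    (ultraIn_nonempty (fun _ _ h => combV_mono (above_antitone X h)) hV)
    (fun _ hx _ hy => mul_mem_ultraIn (exists_mul_mem_combV_above hX) hx hy)
    (fun _ hx _ hu => mul_mem_ultraIn (exists_mul_constHom_mem_combV_above hX) hx (hconst hu))
    (fun _ hu _ hx => mul_mem_ultraIn (exists_constHom_mul_mem_combV_above hX) (hconst hu) hx)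
    (fun a _ hx => map_mem_ultraIn (fun _ _ hp => substA_mem_combA hp a) hx)
  exact ⟨u, v, huu, hv, hvu⟩

end Words

/-- For every infinite block sequence `X` and coloring `f : [X]_A → C`, there are a
finite `F ⊆ [X]_{A⋆}` and an infinite block sequence `Y ⊆ [X − F]_{A⋆}` such that `F`
half-matches `Y` for every color `i ∈ C`. -/
theorem half_match_all_colors {A C : Type*} [Fintype A] [Nonempty A] [Fintype C]
    (X : Set (ℕ → Option (Option A))) (hX : IsBlockSeq X) (hXinf : X.Infinite)
    (f : (ℕ → Option A) → C) :
    ∃ F : Set (ℕ → Option (Option A)), F.Finite ∧ F ⊆ combV X ∧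
      ∃ Y : Set (ℕ → Option (Option A)), Y ⊆ combV (sminus X F) ∧
        IsBlockSeq Y ∧ Y.Infinite ∧
        ∀ i : C, ∀ q ∈ combA Y, f q = i → ∃ p ∈ F, ∀ a : A, f (pun (substA p a) q) = i := by
  obtain ⟨u, v, huu, hv, hvu⟩ := exists_idempotent_combA_combV hX hXinf
  obtain ⟨i, hi⟩ := (u.map f).eq_pure_of_finite
  have hP : f ⁻¹' {i} ∈ u := by
    have : {i} ∈ u.map f := hi ▸ Set.mem_singleton i
    exact this
  obtain ⟨y, m, D, hD0, hm, hD, hyV, hyR, hyD, hmul⟩ :=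
    exists_seq_of_idempotent (σ := fun a p => substA p a) huu hvu hP hv (R := domBelow)
      fun n p hp => exists_domBelow
        (isLVW_of_mem_combV hX (combV_mono (fun _ h => h.1) hp)).1.1 n
  have hyX : ∀ n, y n ∈ combV X := fun n => combV_mono (fun _ h => h.1) (hyV n)
  have hlt : ∀ j k, j < k → blt (y j) (y k) := fun j k hjk s hs t ht =>
    (hyR j s hs).trans_le ((hm hjk).trans (domAbove_of_mem_combV (hyV k) t ht))
  have hlt_of : ∀ j k, blt (y j) (y k) → j < k := fun j k hjk => by
    obtain ⟨s, hs⟩ := (isLVW_of_mem_combV hX (hyX j)).1.2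
    by_contra! hkj
    rcases hkj.eq_or_lt with rfl | hkj
    · exact lt_irrefl _ (hjk s hs s hs)
    · obtain ⟨t, ht⟩ := (isLVW_of_mem_combV hX (hyX k)).1.2
      exact lt_asymm (hjk s hs t ht) (hlt k j hkj t ht s hs)
  have hinj : Function.Injective y := fun j k hjk => by
    by_contra hne
    rcases lt_or_gt_of_ne hne with h | h
    · exact lt_irrefl _ (hlt_of k k (hjk ▸ hlt j k h))
    · exact lt_irrefl _ (hlt_of k k (hjk ▸ hlt k j h))
  refine ⟨{y 0}, Set.finite_singleton _, by simpa using hyX 0, Set.range fun n => y (n + 1),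
    ?_, ⟨?_, ?_⟩, Set.infinite_range_of_injective (hinj.comp (add_left_injective 1)), ?_⟩
  · rintro _ ⟨n, rfl⟩
    refine combV_mono (Y := sminus X {y 0}) (fun p hp => ⟨hp.1, ?_⟩) (hyV (n + 1))
    rintro _ rfl s hs t ht
    exact (hyR 0 s hs).trans_le ((hm (by omega)).trans (hp.2 t ht))
  · rintro _ ⟨n, rfl⟩
    exact isLVW_of_mem_combV hX (hyX _)
  · rintro _ ⟨j, rfl⟩ _ ⟨k, rfl⟩
    rcases lt_trichotomy j k with h | rfl | h
    · exact Or.inr (Or.inl (hlt _ _ (by omega)))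
    · exact Or.inl rfl
    · exact Or.inr (Or.inr (hlt _ _ (by omega)))
  · rintro _ q hq rfl
    have hq1 : q ∈ D 1 := by
      obtain ⟨l, hne, ⟨hlY, hl⟩, rfl⟩ := mem_combA_iff.1 hq
      let ind := Function.invFun y
      have hind : ∀ x ∈ l, y (ind x.1) = x.1 ∧ 1 ≤ ind x.1 := fun x hx => by
        obtain ⟨k, hk⟩ := hlY x hx
        have : ind x.1 = k + 1 := hk ▸ Function.leftInverse_invFun hinj (k + 1)
        exact ⟨this ▸ hk, by omega⟩
      have h := prod_mem_of_seq (σ := fun a p => substA p a) hD hyD hmul 1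
        (l := l.map fun x => (ind x.1, x.2)) (by simpa)
        (List.pairwise_map.2 (hl.imp_of_mem fun hx hz hxz => hlt_of _ _ (by
          rwa [(hind _ hx).1, (hind _ hz).1])))
        (List.forall_mem_map.2 fun x hx => (hind x hx).2)
      rw [List.map_map] at h
      convert h using 2
      exact List.map_congr_left fun x hx => by simp [(hind x hx).1]
    refine ⟨y 0, rfl, fun a => ?_⟩
    have h1 : f q = i := hD0 (hD zero_le_one hq1)
    rw [h1]
    exact hD0 (hmul 0 a q hq1)

end Carlson
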